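/- Let Ω₁, Ω₂ ⊂ ℂ^N be bounded domains with C²-smooth boundaries and let f be a biholomorphism of Ω₁ onto Ω₂ extending to a biholomorphism between neighborhoods of their closures. Then there exists a constant C > 0 such that for all z, w ∈ Ω₁: ‖(f(z)−f(w))_{f(z)}‖ ≤ C·(‖(z−w)_z‖ + ‖z−w‖² + δ_{Ω₁}(z)·‖z−w‖), where the normal component on the left is taken in Ω₂ with respect to π_{Ω₂}(f(z)). -/

import Mathlib

open Metric Set Filter Topology MeasureTheory

noncomputable section

namespace InvDist

/-- Complex Euclidean `N`-space. -/
abbrev E (N : ℕ) := EuclideanSpace ℂ (Fin N)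

variable {N : ℕ}

/-- The paper's Hermitian product `⟨a,b⟩ = ∑ a_j * conj (b_j)`. -/
def herm (a b : E N) : ℂ := ∑ j, a j * (starRingEnd ℂ) (b j)

/-- Euclidean distance to the boundary of `Ω`. -/
def bdist (Ω : Set (E N)) (x : E N) : ℝ := Metric.infDist x (frontier Ω)

/-- `π` selects, for each point of `Ω`, a closest point on the boundary. -/
def IsClosestPointSelection (Ω : Set (E N)) (π : E N → E N) : Prop :=
  ∀ z ∈ Ω, π z ∈ frontier Ω ∧ dist z (π z) = bdist Ω z

/-- `‖v_z‖`: modulus of the complex normal component of `v` with respect to the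
closest boundary point `π z`; the outer unit normal at `π z` is `(π z - z)/‖π z - z‖`. -/
def ncomp (Ω : Set (E N)) (π : E N → E N) (z v : E N) : ℝ :=
  ‖herm v (π z - z)‖ / bdist Ω z

/-- `‖v_z^ℝ‖`: modulus of the real normal component of `v` at `π z`. -/
def ncompR (Ω : Set (E N)) (π : E N → E N) (z v : E N) : ℝ :=
  |(herm v (π z - z)).re| / bdist Ω z

/-- The quantity `A_Ω(z,w)`. -/
def Afun (Ω : Set (E N)) (π : E N → E N) (z w : E N) : ℝ :=
  (ncomp Ω π z (z - w) + ‖z - w‖ ^ 2 + ‖z - w‖ * Real.sqrt (bdist Ω z)) /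
    (Real.sqrt (bdist Ω z) * Real.sqrt (bdist Ω w))

/-- `h_Ω(z,w) = ‖(z-w)_z‖ + ‖z-w‖ δ_Ω(z)^{1/2}`. -/
def hfun (Ω : Set (E N)) (π : E N → E N) (z w : E N) : ℝ :=
  ncomp Ω π z (z - w) + ‖z - w‖ * Real.sqrt (bdist Ω z)

/-- real analogue of `h_Ω`. -/
def hfunR (Ω : Set (E N)) (π : E N → E N) (z w : E N) : ℝ :=
  ncompR Ω π z (z - w) + ‖z - w‖ * Real.sqrt (bdist Ω z)

/-- inverse hyperbolic tangent -/
def artanh (x : ℝ) : ℝ := Real.log ((1 + x) / (1 - x)) / 2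

/-- The Lempert function of `Ω`. -/
def lempert (Ω : Set (E N)) (z w : E N) : ℝ :=
  artanh (sInf { r : ℝ | ∃ φ : ℂ → E N, DifferentiableOn ℂ φ (ball 0 1) ∧
    MapsTo φ (ball (0:ℂ) 1) Ω ∧ φ 0 = z ∧ ∃ a ∈ ball (0:ℂ) 1, φ a = w ∧ r = ‖a‖ })

/-- The Carathéodory distance of `Ω`. -/
def caratheodory (Ω : Set (E N)) (z w : E N) : ℝ :=
  artanh (sSup { r : ℝ | ∃ f : E N → ℂ, DifferentiableOn ℂ f Ω ∧
    MapsTo f Ω (ball (0:ℂ) 1) ∧ f z = 0 ∧ r = ‖f w‖ })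

/-- The Kobayashi distance: the largest pseudodistance not exceeding the Lempert
function, given as an infimum over chains. -/
def kobayashi (Ω : Set (E N)) (z w : E N) : ℝ :=
  sInf { r : ℝ | ∃ (n : ℕ) (p : Fin (n + 1) → E N), p 0 = z ∧ p (Fin.last n) = w ∧
    (∀ i, p i ∈ Ω) ∧ r = ∑ i : Fin n, lempert Ω (p i.castSucc) (p i.succ) }

/-- The Poincaré distance on the unit disc. -/
def poincare (ζ ξ : ℂ) : ℝ := artanh ‖(ζ - ξ) / (1 - (starRingEnd ℂ) ζ * ξ)‖

/-- A complex geodesic of `Ω`. -/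
def IsComplexGeodesic (Ω : Set (E N)) (φ : ℂ → E N) : Prop :=
  DifferentiableOn ℂ φ (ball 0 1) ∧ MapsTo φ (ball (0:ℂ) 1) Ω ∧
    ∀ ζ ∈ ball (0:ℂ) 1, ∀ ξ ∈ ball (0:ℂ) 1, kobayashi Ω (φ ζ) (φ ξ) = poincare ζ ξ

/-- `ρ` is `C^k` on `U` with `α`-Hölder `k`-th derivative. -/
def IsCkHolderOn (k : ℕ) (α : ℝ) (ρ : E N → ℝ) (U : Set (E N)) : Prop :=
  ContDiffOn ℝ k ρ U ∧ ∃ M : ℝ, ∀ x ∈ U, ∀ y ∈ U,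
    ‖iteratedFDeriv ℝ k ρ x - iteratedFDeriv ℝ k ρ y‖ ≤ M * ‖x - y‖ ^ α

/-- The Levi form of `ρ` at `p` evaluated at `v`. -/
def levi (ρ : E N → ℝ) (p v : E N) : ℝ :=
  (iteratedFDeriv ℝ 2 ρ p ![v, v] +
    iteratedFDeriv ℝ 2 ρ p ![(Complex.I : ℂ) • v, (Complex.I : ℂ) • v]) / 4

/-- Bounded strongly pseudoconvex domain with `C^{k,α}`-smooth boundary. -/
def IsStronglyPseudoconvexDomain (k : ℕ) (α : ℝ) (Ω : Set (E N)) : Prop :=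
  IsOpen Ω ∧ IsConnected Ω ∧ Bornology.IsBounded Ω ∧
  ∃ (U : Set (E N)) (ρ : E N → ℝ), IsOpen U ∧ closure Ω ⊆ U ∧
    IsCkHolderOn k α ρ U ∧ Ω = {x ∈ U | ρ x < 0} ∧
    (∀ p ∈ frontier Ω, fderiv ℝ ρ p ≠ 0) ∧
    ∀ p ∈ frontier Ω, ∀ v : E N, v ≠ 0 → fderiv ℝ ρ p v = 0 →
      fderiv ℝ ρ p ((Complex.I : ℂ) • v) = 0 → 0 < levi ρ p v

/-- `η` is the outer unit normal of `Ω` at the boundary point `p`. -/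
def IsOuterUnitNormalAt (Ω : Set (E N)) (p η : E N) : Prop :=
  ‖η‖ = 1 ∧ p ∈ frontier Ω ∧ ∃ ε > 0, ∀ t : ℝ, 0 < t → t < ε →
    p - t • η ∈ Ω ∧ bdist Ω (p - t • η) = t

open Classical in
/-- signed boundary distance -/
def signedDist (Ω : Set (E N)) (x : E N) : ℝ :=
  if x ∈ closure Ω then -(bdist Ω x) else bdist Ω x

/-- Hessian quadratic form of the signed boundary distance. -/
def hessSD (Ω : Set (E N)) (p v : E N) : ℝ :=
  iteratedFDeriv ℝ 2 (signedDist Ω) p ![v, v]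

/-- strict linear convexity at `p` (with outer unit normal `η`). -/
def StrictlyLinearlyConvexAt (Ω : Set (E N)) (p η : E N) : Prop :=
  ∀ v : E N, v ≠ 0 → herm v η = 0 → 0 < hessSD Ω p v

/-- strong convexity at `p` (with outer unit normal `η`). -/
def StronglyConvexAt (Ω : Set (E N)) (p η : E N) : Prop :=
  ∀ v : E N, v ≠ 0 → (herm v η).re = 0 → 0 < hessSD Ω p v

/-- `p` is a `C^k`-smooth boundary point of `Ω`. -/
def IsCkBoundaryPoint (k : ℕ) (Ω : Set (E N)) (p : E N) : Prop :=
  p ∈ frontier Ω ∧ ∃ (U : Set (E N)) (ρ : E N → ℝ), IsOpen U ∧ p ∈ U ∧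
    ContDiffOn ℝ k ρ U ∧ (∀ x ∈ U, (x ∈ Ω ↔ ρ x < 0)) ∧
    ∀ x ∈ U ∩ frontier Ω, fderiv ℝ ρ x ≠ 0

/-- bounded domain with `C^k`-smooth boundary. -/
def IsCkDomain (k : ℕ) (Ω : Set (E N)) : Prop :=
  IsOpen Ω ∧ IsConnected Ω ∧ Bornology.IsBounded Ω ∧
    ∀ p ∈ frontier Ω, IsCkBoundaryPoint k Ω p

/-- bounded domain with `C^{1,1}`-smooth boundary. -/
def IsC11Domain (Ω : Set (E N)) : Prop :=
  IsOpen Ω ∧ IsConnected Ω ∧ Bornology.IsBounded Ω ∧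
  ∀ p ∈ frontier Ω, ∃ (U : Set (E N)) (ρ : E N → ℝ), IsOpen U ∧ p ∈ U ∧
    IsCkHolderOn 1 1 ρ U ∧ (∀ x ∈ U, (x ∈ Ω ↔ ρ x < 0)) ∧
    ∀ x ∈ U ∩ frontier Ω, fderiv ℝ ρ x ≠ 0

/-- `p` is a `C^{2,α}`-smooth strongly pseudoconvex boundary point of `Ω`. -/
def IsSPSCBoundaryPoint (α : ℝ) (Ω : Set (E N)) (p : E N) : Prop :=
  p ∈ frontier Ω ∧ ∃ (U : Set (E N)) (ρ : E N → ℝ), IsOpen U ∧ p ∈ U ∧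
    IsCkHolderOn 2 α ρ U ∧ (∀ x ∈ U, (x ∈ Ω ↔ ρ x < 0)) ∧
    (∀ x ∈ U ∩ frontier Ω, fderiv ℝ ρ x ≠ 0) ∧
    ∀ x ∈ U ∩ frontier Ω, ∀ v : E N, v ≠ 0 → fderiv ℝ ρ x v = 0 →
      fderiv ℝ ρ x ((Complex.I : ℂ) • v) = 0 → 0 < levi ρ x v

instance (N : ℕ) : MeasurableSpace (E N) := borel _

instance (N : ℕ) : BorelSpace (E N) := ⟨rfl⟩

/-- Lebesgue measure on `E N`. -/
def vol (N : ℕ) : Measure (E N) :=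
  letI : InnerProductSpace ℝ (E N) := InnerProductSpace.rclikeToReal ℂ (E N)
  letI : MeasureSpace (E N) := measureSpaceOfInnerProductSpace
  volume

/-- Bergman kernel on the diagonal. -/
def bergmanKernelDiag (Ω : Set (E N)) (z : E N) : ℝ :=
  sSup { r : ℝ | ∃ f : E N → ℂ, DifferentiableOn ℂ f Ω ∧
    (∫ x in Ω, ‖f x‖ ^ 2 ∂(vol N)) ≤ 1 ∧ r = ‖f z‖ ^ 2 }

/-- `M_Ω(z;v)`. -/
def bergmanM (Ω : Set (E N)) (z v : E N) : ℝ :=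
  sSup { r : ℝ | ∃ f : E N → ℂ, DifferentiableOn ℂ f Ω ∧
    (∫ x in Ω, ‖f x‖ ^ 2 ∂(vol N)) ≤ 1 ∧ f z = 0 ∧ r = ‖fderiv ℂ f z v‖ }

/-- The Bergman metric. -/
def bergmanMetric (Ω : Set (E N)) (z v : E N) : ℝ :=
  bergmanM Ω z v / Real.sqrt (bergmanKernelDiag Ω z)

/-- The Bergman distance: inner distance of the Bergman metric. -/
def bergmanDist (Ω : Set (E N)) (z w : E N) : ℝ :=
  sInf { r : ℝ | ∃ γ : ℝ → E N, ContDiffOn ℝ 1 γ (Icc 0 1) ∧ γ 0 = z ∧ γ 1 = w ∧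
    (∀ t ∈ Icc (0:ℝ) 1, γ t ∈ Ω) ∧
    r = ∫ t in (0:ℝ)..(1:ℝ), bergmanMetric Ω (γ t) (derivWithin γ (Icc 0 1) t) }


lemma exists_lipschitz_fderiv_of_differentiableOn {U : Set (E N)} {f : E N → E N}
    (hU : IsOpen U) (hf : DifferentiableOn ℂ f U) {x₀ : E N} (hx₀ : x₀ ∈ U) :
    ∃ r > 0, ∃ L > 0, ball x₀ r ⊆ U ∧ (∀ x ∈ ball x₀ r, ‖fderiv ℂ f x‖ ≤ L) ∧
      (∀ x ∈ ball x₀ r, ∀ y ∈ ball x₀ r, ‖f x - f y‖ ≤ L * ‖x - y‖) ∧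
      ∀ x ∈ ball x₀ r, ∀ y ∈ ball x₀ r, ‖fderiv ℂ f x - fderiv ℂ f y‖ ≤ L * ‖x - y‖ := by
  have hnhds : ∀ᶠ x in 𝓝 x₀, x ∈ U ∧ f x ∈ ball (f x₀) 1 :=
    (hU.eventually_mem hx₀).and ((hf.continuousOn.continuousAt (hU.mem_nhds hx₀)).eventually_mem
      (ball_mem_nhds _ one_pos))
  obtain ⟨R, hR, hball⟩ := Metric.eventually_nhds_iff_ball.1 hnhds
  set s := R / 2 with hs
  have hspos : 0 < s := by positivity
  set K := 2 / s with hK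
  have hKpos : 0 < K := by positivity
  have hsub : ∀ x ∈ ball x₀ s, ball x s ⊆ ball x₀ R := fun x hx ↦
    ball_subset_ball' (by rw [mem_ball] at hx; linarith)
  have hderiv : ∀ x ∈ ball x₀ s, ‖fderiv ℂ f x‖ ≤ K := by
    intro x hx
    refine Complex.norm_fderiv_le_div_of_mapsTo_ball
      (hf.mono fun y hy ↦ (hball y (hsub x hx hy)).1) (fun y hy ↦ ?_) hspos
    have h1 := (hball y (hsub x hx hy)).2
    have h2 := (hball x (hsub x hx (mem_ball_self hspos))).2
    rw [mem_ball] at h1 h2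
    rw [mem_closedBall]
    linarith [dist_triangle_right (f y) (f x) (f x₀)]
  have hdiff : ∀ x ∈ ball x₀ R, DifferentiableAt ℂ f x := fun x hx ↦
    hf.differentiableAt (hU.mem_nhds (hball x hx).1)
  have hsR : ball x₀ s ⊆ ball x₀ R := ball_subset_ball (by linarith)
  have hlip : ∀ x ∈ ball x₀ s, ∀ y ∈ ball x₀ s, ‖f x - f y‖ ≤ K * ‖x - y‖ := fun x hx y hy ↦
    (convex_ball x₀ s).norm_image_sub_le_of_norm_fderiv_le (fun a ha ↦ hdiff a (hsR ha))
      hderiv hy hx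
  have hhalf : ball x₀ (s / 2) ⊆ ball x₀ s := ball_subset_ball (by linarith)
  refine ⟨s / 2, by positivity, max K (2 * K / (s / 2)), by positivity,
    fun x hx ↦ (hball x (hsR (hhalf hx))).1,
    fun x hx ↦ (hderiv x (hhalf hx)).trans (le_max_left _ _),
    fun x hx y hy ↦ (hlip x (hhalf hx) y (hhalf hy)).trans (by gcongr; exact le_max_left _ _),
    fun x hx y hy ↦ ?_⟩
  have hshift : ∀ a ∈ ball x₀ (s / 2), ∀ v ∈ ball (0 : E N) (s / 2), a + v ∈ ball x₀ s := by
    intro a ha v hv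
    rw [mem_ball, dist_eq_norm] at ha ⊢
    rw [mem_ball_zero_iff] at hv
    calc ‖a + v - x₀‖ = ‖(a - x₀) + v‖ := by congr 1; abel
      _ ≤ _ := norm_add_le _ _
      _ < s := by linarith
  have hder : ∀ a ∈ ball x₀ (s / 2), ∀ v ∈ ball (0 : E N) (s / 2),
      HasFDerivAt (fun v ↦ f (a + v)) (fderiv ℂ f (a + v)) v := fun a ha v hv ↦
    (hasFDerivAt_comp_add_left a).2 (hdiff _ (hsR (hshift a ha v hv))).hasFDerivAt
  have h0 : (0 : E N) ∈ ball (0 : E N) (s / 2) := mem_ball_self (by positivity)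
  have hdh : ∀ v ∈ ball (0 : E N) (s / 2), HasFDerivAt (fun v ↦ f (x + v) - f (y + v))
      (fderiv ℂ f (x + v) - fderiv ℂ f (y + v)) v := fun v hv ↦
    (hder x hx v hv).sub (hder y hy v hv)
  have key := Complex.norm_fderiv_le_div_of_mapsTo_ball (R₂ := 2 * K * ‖x - y‖)
    (fun v hv ↦ (hdh v hv).differentiableAt.differentiableWithinAt) (fun v hv ↦ by
      have h1 := hlip _ (hshift x hx v hv) _ (hshift y hy v hv)
      have h2 := hlip _ (hshift x hx 0 h0) _ (hshift y hy 0 h0)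
      rw [add_sub_add_right_eq_sub] at h1 h2
      rw [mem_closedBall, dist_eq_norm]
      exact (norm_sub_le _ _).trans (by linarith)) (half_pos hspos)
  rw [(hdh 0 h0).fderiv, add_zero, add_zero] at key
  refine key.trans ?_
  rw [mul_div_right_comm]
  gcongr
  exact le_max_right _ _

lemma herm_eq_inner (a b : E N) : herm a b = inner ℂ b a := rfl

lemma bdist_nonneg (Ω : Set (E N)) (z : E N) : 0 ≤ bdist Ω z := Metric.infDist_nonneg

lemma ncomp_nonneg (Ω : Set (E N)) (π : E N → E N) (z v : E N) : 0 ≤ ncomp Ω π z v :=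
  div_nonneg (norm_nonneg _) (bdist_nonneg Ω z)

lemma ncomp_smul (Ω : Set (E N)) (π : E N → E N) (z v : E N) (c : ℂ) :
    ncomp Ω π z (c • v) = ‖c‖ * ncomp Ω π z v := by
  rw [ncomp, ncomp, herm_eq_inner, herm_eq_inner, inner_smul_right, norm_mul, mul_div_assoc]

lemma IsClosestPointSelection.norm_sub_eq {Ω : Set (E N)} {π : E N → E N}
    (hπ : IsClosestPointSelection Ω π) {z : E N} (hz : z ∈ Ω) : ‖π z - z‖ = bdist Ω z := by
  rw [← (hπ z hz).2, dist_eq_norm_sub']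

lemma IsClosestPointSelection.bdist_pos {Ω : Set (E N)} {π : E N → E N}
    (hπ : IsClosestPointSelection Ω π) (hΩ : IsOpen Ω) {z : E N} (hz : z ∈ Ω) :
    0 < bdist Ω z :=
  (isClosed_frontier.notMem_iff_infDist_pos ⟨π z, (hπ z hz).1⟩).1
    fun h ↦ (hΩ.frontier_eq ▸ h).2 hz

lemma IsClosestPointSelection.ncomp_le_norm {Ω : Set (E N)} {π : E N → E N}
    (hπ : IsClosestPointSelection Ω π) {z : E N} (hz : z ∈ Ω) (v : E N) :
    ncomp Ω π z v ≤ ‖v‖ := by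
  refine div_le_of_le_mul₀ (bdist_nonneg Ω z) (norm_nonneg v) ?_
  rw [herm_eq_inner, ← hπ.norm_sub_eq hz, mul_comm]
  exact norm_inner_le_norm _ _

lemma ball_bdist_subset {Ω : Set (E N)} (hΩ : IsOpen Ω) {z : E N} (hz : z ∈ Ω) :
    ball z (bdist Ω z) ⊆ Ω := by
  rcases (bdist_nonneg Ω z).eq_or_lt with h | h
  · simp [← h]
  refine (convex_ball z _).isPreconnected.subset_of_closure_inter_subset hΩ
    ⟨z, mem_ball_self h, hz⟩ fun x hx ↦ ?_
  by_contra hxΩ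
  have hfr : x ∈ frontier Ω := by
    rw [hΩ.frontier_eq]
    exact ⟨hx.1, hxΩ⟩
  have h1 := Metric.infDist_le_dist_of_mem (x := z) hfr
  have h2 := mem_ball'.1 hx.2
  exact absurd h1 (not_le.2 h2)

/-- At a boundary point closest to `z`, the differential of a defining function is nonpositive
in directions pointing towards `z`. -/
lemma fderiv_nonpos_of_closest {Ω : Set (E N)} (hΩ : IsOpen Ω) {z p : E N} (hz : z ∈ Ω)
    (hp : p ∈ frontier Ω) (hd : ‖p - z‖ = bdist Ω z) {ρ : E N → ℝ} {ρ' : E N →L[ℝ] ℝ}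
    (hρ : HasFDerivAt ρ ρ' p) (hiff : ∀ᶠ x in 𝓝 p, (x ∈ Ω ↔ ρ x < 0)) {u : E N}
    (hu : (inner ℂ (p - z) u).re < 0) : ρ' u ≤ 0 := by
  have hρp : 0 ≤ ρ p := by
    by_contra! h
    exact (hΩ.frontier_eq ▸ hp).2 (hiff.self_of_nhds.2 h)
  have hline : HasDerivAt (fun t : ℝ ↦ ρ (p + t • u)) (ρ' u) 0 := by
    have h1 : HasDerivAt (fun t : ℝ ↦ p + t • u) u 0 := by
      simpa using ((hasDerivAt_id (0 : ℝ)).smul_const u).const_add p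
    have h2 : HasFDerivAt ρ ρ' (p + (0 : ℝ) • u) := by simpa using hρ
    exact h2.comp_hasDerivAt 0 h1
  have hcont : Tendsto (fun t : ℝ ↦ p + t • u) (𝓝[>] 0) (𝓝 p) := by
    have : Continuous fun t : ℝ ↦ p + t • u := by fun_prop
    simpa using (this.tendsto 0).mono_left nhdsWithin_le_nhds
  have hquad : ∀ᶠ t : ℝ in 𝓝[>] 0, 2 * (inner ℂ (p - z) u).re + t * ‖u‖ ^ 2 < 0 := by
    have : Continuous fun t : ℝ ↦ 2 * (inner ℂ (p - z) u).re + t * ‖u‖ ^ 2 := by fun_prop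
    exact ((this.tendsto 0).mono_left nhdsWithin_le_nhds).eventually_lt_const
      (by linarith)
  have hslope := hline.tendsto_slope_zero_right
  refine le_of_tendsto hslope ?_
  filter_upwards [hcont.eventually hiff, hquad, self_mem_nhdsWithin] with t ht hq ht0
  have ht0 : 0 < t := ht0
  have hmem : p + t • u ∈ Ω := by
    apply ball_bdist_subset hΩ hz
    rw [mem_ball, dist_eq_norm, ← hd]
    refine lt_of_pow_lt_pow_left₀ 2 (norm_nonneg _) ?_
    have hre : (inner ℂ (p - z) (t • u)).re = t * (inner ℂ (p - z) u).re := by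
      rw [← Complex.coe_smul, inner_smul_right, Complex.re_ofReal_mul]
    have hexp := norm_add_sq (𝕜 := ℂ) (p - z) (t • u)
    rw [RCLike.re_eq_complex_re, hre, norm_smul, Real.norm_of_nonneg ht0.le] at hexp
    rw [show p + t • u - z = p - z + t • u by abel, hexp]
    nlinarith
  have := ht.1 hmem
  rw [zero_add, zero_smul, add_zero, smul_eq_mul]
  exact mul_nonpos_of_nonneg_of_nonpos (by positivity) (by linarith)

lemma fderiv_eq_of_closest {Ω : Set (E N)} (hΩ : IsOpen Ω) {z p : E N} (hz : z ∈ Ω)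
    (hp : p ∈ frontier Ω) (hd : ‖p - z‖ = bdist Ω z) {ρ : E N → ℝ} {ρ' : E N →L[ℝ] ℝ}
    (hρ : HasFDerivAt ρ ρ' p) (hiff : ∀ᶠ x in 𝓝 p, (x ∈ Ω ↔ ρ x < 0)) (u : E N) :
    ρ' u = (inner ℂ (p - z) u).re / ‖p - z‖ ^ 2 * ρ' (p - z) := by
  have hne : p - z ≠ 0 := by
    rintro h
    exact (hΩ.frontier_eq ▸ hp).2 (sub_eq_zero.1 h ▸ hz)
  have hpos : 0 < ‖p - z‖ ^ 2 := by positivity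
  have hre : ∀ (t : ℝ) (v : E N),
      (inner ℂ (p - z) (t • v)).re = t * (inner ℂ (p - z) v).re := fun t v ↦ by
    rw [← Complex.coe_smul, inner_smul_right, Complex.re_ofReal_mul]
  have hself : (inner ℂ (p - z) (p - z)).re = ‖p - z‖ ^ 2 := by
    rw [← RCLike.re_eq_complex_re, inner_self_eq_norm_sq]
  have hle : ∀ v : E N, (inner ℂ (p - z) v).re = 0 → ρ' v ≤ 0 := by
    intro v hv
    have hε : ∀ ε : ℝ, 0 < ε → ρ' v - ε * ρ' (p - z) ≤ 0 := by
      intro ε hε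
      have := fderiv_nonpos_of_closest hΩ hz hp hd hρ hiff (u := v - ε • (p - z)) (by
        rw [inner_sub_right, Complex.sub_re, hv, hre, hself]
        nlinarith)
      simpa using this
    have hc : Continuous fun ε : ℝ ↦ ρ' v - ε * ρ' (p - z) := by fun_prop
    have hlim := (hc.tendsto 0).mono_left (nhdsWithin_le_nhds (s := Ioi (0 : ℝ)))
    simpa using le_of_tendsto hlim (by filter_upwards [self_mem_nhdsWithin] with ε h using hε ε h)
  set a := (inner ℂ (p - z) u).re / ‖p - z‖ ^ 2 with ha
  have horth : (inner ℂ (p - z) (u - a • (p - z))).re = 0 := by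
    rw [inner_sub_right, Complex.sub_re, hre, hself, ha]
    field_simp
    ring
  have h1 := hle _ horth
  have h2 := hle (-(u - a • (p - z))) (by rw [inner_neg_right, Complex.neg_re, horth, neg_zero])
  rw [map_neg] at h2
  rw [map_sub ρ' u, map_smul, smul_eq_mul] at h1 h2
  linarith

section ClosestPoint

variable {Ω : Set (E N)} {π : E N → E N} {z : E N} {ρ : E N → ℝ} {ρ' : E N →L[ℝ] ℝ}

lemma abs_fderiv_le_norm_mul_ncomp (hΩ : IsOpen Ω) (hπ : IsClosestPointSelection Ω π)
    (hz : z ∈ Ω) (hρ : HasFDerivAt ρ ρ' (π z))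
    (hiff : ∀ᶠ x in 𝓝 (π z), (x ∈ Ω ↔ ρ x < 0)) (u : E N) :
    |ρ' u| ≤ ‖ρ'‖ * ncomp Ω π z u := by
  have hpos := hπ.bdist_pos hΩ hz
  have hn := hπ.norm_sub_eq hz
  rw [fderiv_eq_of_closest hΩ hz (hπ z hz).1 hn hρ hiff u, abs_mul, abs_div,
    abs_of_nonneg (by positivity : (0 : ℝ) ≤ ‖π z - z‖ ^ 2), hn, ncomp, herm_eq_inner]
  have h1 : |ρ' (π z - z)| ≤ ‖ρ'‖ * bdist Ω z := hn ▸ ρ'.le_opNorm (π z - z)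
  have h2 := Complex.abs_re_le_norm (inner ℂ (π z - z) u)
  calc _ ≤ ‖inner ℂ (π z - z) u‖ / bdist Ω z ^ 2 * (‖ρ'‖ * bdist Ω z) := by gcongr
    _ = _ := by field_simp

lemma exists_norm_mul_ncomp_le (hΩ : IsOpen Ω) (hπ : IsClosestPointSelection Ω π)
    (hz : z ∈ Ω) (hρ : HasFDerivAt ρ ρ' (π z))
    (hiff : ∀ᶠ x in 𝓝 (π z), (x ∈ Ω ↔ ρ x < 0)) (u : E N) :
    ∃ c : ℂ, ‖c‖ = 1 ∧ ‖ρ'‖ * ncomp Ω π z u ≤ |ρ' (c • u)| := by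
  have hpos := hπ.bdist_pos hΩ hz
  have hn := hπ.norm_sub_eq hz
  have heq := fderiv_eq_of_closest hΩ hz (hπ z hz).1 hn hρ hiff
  have hop : ‖ρ'‖ ≤ |ρ' (π z - z)| / bdist Ω z := by
    refine ρ'.opNorm_le_bound (by positivity) fun v ↦ ?_
    rw [heq v, Real.norm_eq_abs, abs_mul, abs_div,
      abs_of_nonneg (by positivity : (0 : ℝ) ≤ ‖π z - z‖ ^ 2), hn]
    have h1 := (Complex.abs_re_le_norm _).trans (norm_inner_le_norm (𝕜 := ℂ) (π z - z) v)
    rw [hn] at h1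
    calc _ ≤ bdist Ω z * ‖v‖ / bdist Ω z ^ 2 * |ρ' (π z - z)| := by gcongr
      _ = _ := by field_simp
  obtain ⟨c, hc, hcu⟩ := RCLike.exists_norm_eq_mul_self (inner ℂ (π z - z) u)
  refine ⟨c, hc, ?_⟩
  have hre : (inner ℂ (π z - z) (c • u)).re = ‖inner ℂ (π z - z) u‖ := by
    rw [inner_smul_right, ← hcu]
    exact Complex.ofReal_re _
  rw [heq, hre, hn, abs_mul, abs_of_nonneg (by positivity), ncomp, herm_eq_inner]
  calc _ ≤ |ρ' (π z - z)| / bdist Ω z * (‖inner ℂ (π z - z) u‖ / bdist Ω z) := by gcongr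
    _ = _ := by field_simp

end ClosestPoint

/-- The estimate for pairs of points near a boundary point of `Ω₁`. -/
lemma exists_ball_ncomp_le_of_mem_frontier {Ω₁ Ω₂ U : Set (E N)} {f : E N → E N}
    {π₁ π₂ : E N → E N} (hΩ₁ : IsOpen Ω₁) (hΩ₂ : IsOpen Ω₂) (hU : IsOpen U)
    (hf : DifferentiableOn ℂ f U) (hmem : ∀ x ∈ U, (x ∈ Ω₁ ↔ f x ∈ Ω₂))
    (hfr : ∀ x ∈ U, x ∈ frontier Ω₁ → f x ∈ frontier Ω₂)
    (hπ₁ : IsClosestPointSelection Ω₁ π₁) (hπ₂ : IsClosestPointSelection Ω₂ π₂)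
    {x₀ : E N} (hx₀ : x₀ ∈ frontier Ω₁) (hx₀U : x₀ ∈ U) (hbd : IsCkBoundaryPoint 2 Ω₂ (f x₀)) :
    ∃ r > 0, ∃ C > 0, ∀ z ∈ ball x₀ r ∩ Ω₁, ∀ w ∈ ball x₀ r ∩ Ω₁,
      ncomp Ω₂ π₂ (f z) (f z - f w) ≤
        C * (ncomp Ω₁ π₁ z (z - w) + ‖z - w‖ ^ 2 + bdist Ω₁ z * ‖z - w‖) := by
  obtain ⟨r, hr, L, hL, hrU, hfn, hlip, hflip⟩ :=
    exists_lipschitz_fderiv_of_differentiableOn hU hf hx₀U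
  obtain ⟨hy₀, V, ρ, hV, hyV, hρ, hiff, hne⟩ := hbd
  have hρat : ContDiffAt ℝ 2 ρ (f x₀) := hρ.contDiffAt (hV.mem_nhds hyV)
  have hρ'at : ContDiffAt ℝ 1 (fderiv ℝ ρ) (f x₀) :=
    hρat.fderiv_right (by norm_num)
  obtain ⟨K, T, hT, hKT⟩ := hρ'at.exists_lipschitzOnWith
  set m := ‖fderiv ℝ ρ (f x₀)‖ / 2 with hm
  have hmpos : 0 < m := half_pos (norm_pos_iff.2 (hne _ ⟨hyV, hy₀⟩))
  set M := ‖fderiv ℝ ρ (f x₀)‖ + 1 with hM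
  have hMpos : 0 < M := by positivity
  have hcn := hρ'at.continuousAt.norm
  have hnear : ∀ᶠ y in 𝓝 (f x₀), y ∈ V ∧ y ∈ T ∧ m < ‖fderiv ℝ ρ y‖ ∧ ‖fderiv ℝ ρ y‖ < M :=
    (hV.eventually_mem hyV).and <| (show ∀ᶠ y in 𝓝 (f x₀), y ∈ T from hT).and <|
      (hcn.eventually_const_lt (by linarith)).and (hcn.eventually_lt_const (by linarith))
  obtain ⟨s, hs, hsball⟩ := Metric.eventually_nhds_iff_ball.1 hnear
  have hfc : ContinuousAt f x₀ := hf.continuousOn.continuousAt (hU.mem_nhds hx₀U)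
  obtain ⟨r', hr', hfball⟩ := Metric.eventually_nhds_iff_ball.1
    (hfc.eventually_mem (ball_mem_nhds (f x₀) (half_pos hs)))
  set t := min r r' / 2 with ht
  have htr : 2 * t ≤ r := by rw [ht]; linarith [min_le_left r r']
  have htr' : 2 * t ≤ r' := by rw [ht]; linarith [min_le_right r r']
  have htpos : 0 < t := by positivity
  refine ⟨t, htpos, (M * L + M * L + 2 * K * L ^ 2) / m, by positivity, ?_⟩
  rintro z ⟨hzt, hz⟩ w ⟨hwt, hw⟩
  have hsub : ∀ {x}, dist x x₀ < 2 * t → x ∈ ball x₀ r := fun h ↦ mem_ball.2 (h.trans_le htr)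
  rw [mem_ball] at hzt hwt
  set d := bdist Ω₁ z with hd
  set e := ‖z - w‖ with he
  set a := ncomp Ω₁ π₁ z (z - w) with ha
  set n := ncomp Ω₂ π₂ (f z) (f z - f w) with hn
  have ha0 : 0 ≤ a := ncomp_nonneg _ _ _ _
  have hd0 : 0 ≤ d := bdist_nonneg _ _
  have he0 : 0 ≤ e := norm_nonneg _
  have hzr : z ∈ ball x₀ r := hsub (by linarith)
  have hwr : w ∈ ball x₀ r := hsub (by linarith)
  -- the closest point of `z` and its image
  set p := π₁ z with hp
  obtain ⟨hpfr, hpd⟩ := hπ₁ z hz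
  have hdle : d ≤ dist z x₀ := Metric.infDist_le_dist_of_mem hx₀
  have hp2 : dist p x₀ < 2 * t := by linarith [dist_triangle_left p x₀ z]
  have hpr : p ∈ ball x₀ r := hsub hp2
  have hfp := hfball p (mem_ball.2 (hp2.trans_le htr'))
  have hfz := hfball z (mem_ball.2 (by linarith))
  rw [mem_ball] at hfp hfz
  obtain ⟨-, hfpT, -, hfpM⟩ := hsball (f p) (mem_ball.2 (by linarith))
  have hfpV := (hsball (f p) (mem_ball.2 (by linarith))).1
  -- the closest point of `f z`
  have hfzΩ : f z ∈ Ω₂ := (hmem z (hrU hzr)).1 hz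
  set q := π₂ (f z) with hq
  obtain ⟨hqfr, hqd⟩ := hπ₂ (f z) hfzΩ
  have hqle : dist (f z) q ≤ dist (f z) (f x₀) := by
    rw [hqd]
    exact Metric.infDist_le_dist_of_mem hy₀
  obtain ⟨hqV, hqT, hqm, -⟩ := hsball q
    (mem_ball.2 (by linarith [dist_triangle_left q (f x₀) (f z)]))
  have hzp : ‖z - p‖ = d := by rw [← dist_eq_norm, hpd]
  have hfzp : ‖f z - f p‖ ≤ L * d := hzp ▸ hlip z hzr p hpr
  have hqz : dist (f z) q ≤ L * d := by
    rw [hqd]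
    refine (Metric.infDist_le_dist_of_mem (hfr p (hrU hpr) hpfr)).trans ?_
    rwa [dist_eq_norm]
  have hqfp : dist q (f p) ≤ 2 * (L * d) := by
    have := dist_triangle_left q (f p) (f z)
    rw [dist_eq_norm (f z) (f p)] at this
    linarith
  -- the two differentials
  have hdiffV : ∀ y ∈ V, HasFDerivAt ρ (fderiv ℝ ρ y) y := fun y hy ↦
    ((hρ.contDiffAt (hV.mem_nhds hy)).differentiableAt (by norm_num)).hasFDerivAt
  have hdf : ∀ x ∈ ball x₀ r, HasFDerivAt f (fderiv ℂ f x) x := fun x hx ↦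
    (hf.differentiableAt (hU.mem_nhds (hrU hx))).hasFDerivAt
  have hcomp : HasFDerivAt (ρ ∘ f) ((fderiv ℝ ρ (f p)).comp ((fderiv ℂ f p).restrictScalars ℝ)) p :=
    (hdiffV _ hfpV).comp p ((hdf p hpr).restrictScalars ℝ)
  obtain ⟨c, hc, hcn⟩ := exists_norm_mul_ncomp_le hΩ₂ hπ₂ hfzΩ (hdiffV q hqV)
    (by filter_upwards [hV.mem_nhds hqV] with y hy using hiff y hy) (f z - f w)
  have htan := abs_fderiv_le_norm_mul_ncomp hΩ₁ hπ₁ hz hcomp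
    (by
      filter_upwards [(hdf p hpr).continuousAt.eventually_mem (hV.mem_nhds hfpV),
        hU.mem_nhds (hrU hpr)] with x hx hxU
      exact (hmem x hxU).trans (hiff _ hx)) (c • (z - w))
  rw [ncomp_smul, hc, one_mul, ← ha] at htan
  have hnorm : ‖(fderiv ℝ ρ (f p)).comp ((fderiv ℂ f p).restrictScalars ℝ)‖ ≤ M * L := by
    refine (ContinuousLinearMap.opNorm_comp_le _ _).trans ?_
    rw [ContinuousLinearMap.norm_restrictScalars]
    exact mul_le_mul hfpM.le (hfn p hpr) (norm_nonneg _) hMpos.le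
  have hfzw : ‖f z - f w‖ ≤ L * e := hlip z hzr w hwr
  have htaylor : ‖f z - f w - fderiv ℂ f p (z - w)‖ ≤ L * (d + e) * e := by
    refine (convex_segment w z).norm_image_sub_le_of_norm_hasFDerivWithin_le' (𝕜 := ℂ)
      (f' := fderiv ℂ f) (fun x hx ↦ ?_) (fun x hx ↦ ?_) (left_mem_segment ℝ w z)
      (right_mem_segment ℝ w z)
    · exact (hdf x ((convex_ball x₀ r).segment_subset hwr hzr hx)).hasFDerivWithinAt
    · refine (hflip x ((convex_ball x₀ r).segment_subset hwr hzr hx) p hpr).trans ?_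
      gcongr
      have hxz : ‖x - z‖ ≤ e := by
        rw [segment_symm] at hx
        obtain ⟨θ, hθ, rfl⟩ := (segment_eq_image' ℝ z w ▸ hx :)
        rw [add_sub_cancel_left, norm_smul, Real.norm_of_nonneg hθ.1, norm_sub_rev w z]
        exact mul_le_of_le_one_left he0 hθ.2
      linarith [norm_sub_le_norm_sub_add_norm_sub x z p]
  set R := f z - f w - fderiv ℂ f p (z - w) with hR
  have hsplit : fderiv ℝ ρ q (c • (f z - f w)) =
      ((fderiv ℝ ρ (f p)).comp ((fderiv ℂ f p).restrictScalars ℝ)) (c • (z - w)) +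
        fderiv ℝ ρ (f p) (c • R) + (fderiv ℝ ρ q - fderiv ℝ ρ (f p)) (c • (f z - f w)) := by
    have : c • (f z - f w) = fderiv ℂ f p (c • (z - w)) + c • R := by
      rw [map_smul, ← smul_add, hR, add_sub_cancel]
    have h2 := congrArg (fderiv ℝ ρ (f p)) this
    rw [map_add] at h2
    rw [sub_apply, ContinuousLinearMap.comp_apply,
      ContinuousLinearMap.coe_restrictScalars', h2]
    ring
  have hB : |fderiv ℝ ρ (f p) (c • R)| ≤ M * (L * (d + e) * e) := by
    refine ((fderiv ℝ ρ (f p)).le_opNorm _).trans ?_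
    rw [norm_smul, hc, one_mul]
    exact mul_le_mul hfpM.le htaylor (norm_nonneg _) hMpos.le
  have hD : |(fderiv ℝ ρ q - fderiv ℝ ρ (f p)) (c • (f z - f w))| ≤
      K * (2 * (L * d)) * (L * e) := by
    refine ((fderiv ℝ ρ q - fderiv ℝ ρ (f p)).le_opNorm _).trans ?_
    rw [norm_smul, hc, one_mul]
    have := hKT.dist_le_mul q hqT (f p) hfpT
    rw [dist_eq_norm] at this
    exact mul_le_mul (this.trans (by gcongr)) hfzw (norm_nonneg _) (by positivity)
  have htotal : m * n ≤ M * L * a + M * (L * (d + e) * e) + K * (2 * (L * d)) * (L * e) := by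
    calc m * n ≤ ‖fderiv ℝ ρ q‖ * n := by gcongr; exact ncomp_nonneg _ _ _ _
      _ ≤ _ := hcn
      _ ≤ _ := by
        rw [hsplit]
        refine (abs_add_three _ _ _).trans ?_
        gcongr
        exact htan.trans (by gcongr)
  rw [div_mul_eq_mul_div, le_div_iff₀ hmpos, mul_comm n m]
  refine htotal.trans ?_
  have h1 : 0 ≤ M * L * a := by positivity
  have h2 : 0 ≤ M * L * e ^ 2 := by positivity
  have h3 : 0 ≤ M * L * (d * e) := by positivity
  have h4 : 0 ≤ K * L ^ 2 * a := by positivity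
  have h5 : 0 ≤ K * L ^ 2 * e ^ 2 := by positivity
  linarith

/-- The estimate for pairs of points near an interior point of `Ω₁`. -/
lemma exists_ball_ncomp_le_of_mem {Ω₁ Ω₂ U : Set (E N)} {f : E N → E N}
    {π₁ π₂ : E N → E N} (hΩ₁ : IsOpen Ω₁) (hU : IsOpen U)
    (hf : DifferentiableOn ℂ f U) (hmaps : MapsTo f Ω₁ Ω₂)
    (hπ₁ : IsClosestPointSelection Ω₁ π₁) (hπ₂ : IsClosestPointSelection Ω₂ π₂)
    {x₀ : E N} (hx₀ : x₀ ∈ Ω₁) (hx₀U : x₀ ∈ U) :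
    ∃ r > 0, ∃ C > 0, ∀ z ∈ ball x₀ r ∩ Ω₁, ∀ w ∈ ball x₀ r ∩ Ω₁,
      ncomp Ω₂ π₂ (f z) (f z - f w) ≤
        C * (ncomp Ω₁ π₁ z (z - w) + ‖z - w‖ ^ 2 + bdist Ω₁ z * ‖z - w‖) := by
  obtain ⟨r, hr, L, hL, -, -, hlip, -⟩ :=
    exists_lipschitz_fderiv_of_differentiableOn hU hf hx₀U
  have hδ := hπ₁.bdist_pos hΩ₁ hx₀
  have hcont : ContinuousAt (bdist Ω₁) x₀ := (Metric.continuous_infDist_pt _).continuousAt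
  obtain ⟨r', hr', hball⟩ := Metric.eventually_nhds_iff_ball.1
    (hcont.eventually_const_lt (half_lt_self hδ))
  set m := bdist Ω₁ x₀ / 2 with hm
  have hmpos : 0 < m := half_pos hδ
  refine ⟨min r r', by positivity, L / m, by positivity, ?_⟩
  rintro z ⟨hzt, hz⟩ w ⟨hwt, hw⟩
  have hzd := hball z (ball_subset_ball (min_le_right _ _) hzt)
  have hlz := hlip z (ball_subset_ball (min_le_left _ _) hzt) w
    (ball_subset_ball (min_le_left _ _) hwt)
  have ha0 := ncomp_nonneg Ω₁ π₁ z (z - w)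
  calc _ ≤ ‖f z - f w‖ := hπ₂.ncomp_le_norm (hmaps hz) _
    _ ≤ L * ‖z - w‖ := hlz
    _ = L / m * (0 + 0 + m * ‖z - w‖) := by field_simp; ring
    _ ≤ _ := by gcongr; positivity

/-- Upper bound for the complex normal component under a
biholomorphism extending past the closures. -/
theorem stmt11 {N : ℕ}
    (Ω₁ Ω₂ : Set (E N)) (h1 : IsCkDomain 2 Ω₁) (h2 : IsCkDomain 2 Ω₂)
    (U₁ U₂ : Set (E N)) (f g : E N → E N)
    (hU₁ : IsOpen U₁) (hU₂ : IsOpen U₂)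
    (hcl₁ : closure Ω₁ ⊆ U₁) (hcl₂ : closure Ω₂ ⊆ U₂)
    (hf : DifferentiableOn ℂ f U₁) (hg : DifferentiableOn ℂ g U₂)
    (hfU : Set.MapsTo f U₁ U₂) (hgU : Set.MapsTo g U₂ U₁)
    (hgf : ∀ x ∈ U₁, g (f x) = x) (hfg : ∀ y ∈ U₂, f (g y) = y)
    (him : f '' Ω₁ = Ω₂)
    (π₁ π₂ : E N → E N)
    (hπ₁ : IsClosestPointSelection Ω₁ π₁) (hπ₂ : IsClosestPointSelection Ω₂ π₂) :
    ∃ C : ℝ, 0 < C ∧ ∀ z ∈ Ω₁, ∀ w ∈ Ω₁,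
      ncomp Ω₂ π₂ (f z) (f z - f w) ≤
        C * (ncomp Ω₁ π₁ z (z - w) + ‖z - w‖ ^ 2 + bdist Ω₁ z * ‖z - w‖) := by
  have hΩ₁ := h1.1
  have hΩ₂ := h2.1
  have hsub : Ω₁ ⊆ U₁ := subset_closure.trans hcl₁
  have hmaps : MapsTo f Ω₁ Ω₂ := fun x hx ↦ him ▸ mem_image_of_mem f hx
  have hmem : ∀ x ∈ U₁, (x ∈ Ω₁ ↔ f x ∈ Ω₂) := by
    refine fun x hx ↦ ⟨fun h ↦ hmaps h, fun h ↦ ?_⟩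
    rw [← him] at h
    obtain ⟨y, hy, hyx⟩ := h
    rwa [← hgf x hx, ← hyx, hgf y (hsub hy)]
  have hfr : ∀ x ∈ U₁, x ∈ frontier Ω₁ → f x ∈ frontier Ω₂ := by
    intro x hx hxfr
    rw [hΩ₁.frontier_eq] at hxfr
    rw [hΩ₂.frontier_eq]
    exact ⟨((hf.continuousOn.continuousAt (hU₁.mem_nhds hx)).continuousWithinAt).mem_closure
      hxfr.1 hmaps, fun h ↦ hxfr.2 ((hmem x hx).2 h)⟩
  have hcompact : IsCompact (closure Ω₁) := h1.2.2.1.isCompact_closure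
  obtain ⟨D, hD⟩ := isBounded_iff.1 h2.2.2.1
  have hrhs : ∀ z w, 0 ≤ ncomp Ω₁ π₁ z (z - w) + ‖z - w‖ ^ 2 + bdist Ω₁ z * ‖z - w‖ := by
    intro z w
    have h3 := ncomp_nonneg Ω₁ π₁ z (z - w)
    have h4 := bdist_nonneg Ω₁ z
    positivity
  suffices h : ∃ C : ℝ, 0 < C ∧ ∀ z ∈ closure Ω₁ ∩ Ω₁, ∀ w ∈ Ω₁,
      ncomp Ω₂ π₂ (f z) (f z - f w) ≤
        C * (ncomp Ω₁ π₁ z (z - w) + ‖z - w‖ ^ 2 + bdist Ω₁ z * ‖z - w‖) by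
    obtain ⟨C, hC, h⟩ := h
    exact ⟨C, hC, fun z hz ↦ h z ⟨subset_closure hz, hz⟩⟩
  refine hcompact.induction_on (p := fun s ↦ ∃ C : ℝ, 0 < C ∧ ∀ z ∈ s ∩ Ω₁, ∀ w ∈ Ω₁,
      ncomp Ω₂ π₂ (f z) (f z - f w) ≤
        C * (ncomp Ω₁ π₁ z (z - w) + ‖z - w‖ ^ 2 + bdist Ω₁ z * ‖z - w‖)) ?_ ?_ ?_ ?_
  · exact ⟨1, one_pos, by simp⟩
  · rintro s t hst ⟨C, hC, h⟩
    exact ⟨C, hC, fun z hz ↦ h z ⟨hst hz.1, hz.2⟩⟩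
  · rintro s t ⟨C, hC, hs⟩ ⟨C', hC', ht⟩
    refine ⟨max C C', by positivity, ?_⟩
    rintro z ⟨hz | hz, hzΩ⟩ w hw
    · exact (hs z ⟨hz, hzΩ⟩ w hw).trans
        (mul_le_mul_of_nonneg_right (le_max_left _ _) (hrhs z w))
    · exact (ht z ⟨hz, hzΩ⟩ w hw).trans
        (mul_le_mul_of_nonneg_right (le_max_right _ _) (hrhs z w))
  · intro x hx
    have hxU := hcl₁ hx
    have hlocal : ∃ r > 0, ∃ C > 0, ∀ z ∈ ball x r ∩ Ω₁, ∀ w ∈ ball x r ∩ Ω₁,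
        ncomp Ω₂ π₂ (f z) (f z - f w) ≤
          C * (ncomp Ω₁ π₁ z (z - w) + ‖z - w‖ ^ 2 + bdist Ω₁ z * ‖z - w‖) := by
      by_cases hxΩ : x ∈ Ω₁
      · exact exists_ball_ncomp_le_of_mem hΩ₁ hU₁ hf hmaps hπ₁ hπ₂ hxΩ hxU
      · have hxfr : x ∈ frontier Ω₁ := by
          rw [hΩ₁.frontier_eq]
          exact ⟨hx, hxΩ⟩
        exact exists_ball_ncomp_le_of_mem_frontier hΩ₁ hΩ₂ hU₁ hf hmem hfr hπ₁ hπ₂ hxfr hxU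
          (h2.2.2.2 _ (hfr x hxU hxfr))
    obtain ⟨r, hr, C, hC, h⟩ := hlocal
    refine ⟨ball x (r / 2), mem_nhdsWithin_of_mem_nhds (ball_mem_nhds x (half_pos hr)),
      max C (D / (r / 2) ^ 2), by positivity, ?_⟩
    rintro z ⟨hzr, hz⟩ w hw
    rw [mem_ball] at hzr
    by_cases hwr : dist w x < r
    · exact (h z ⟨mem_ball.2 (by linarith), hz⟩ w ⟨hwr, hw⟩).trans
        (mul_le_mul_of_nonneg_right (le_max_left _ _) (hrhs z w))
    · refine le_trans ?_ (mul_le_mul_of_nonneg_right (le_max_right _ _) (hrhs z w))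
      have hfD : ‖f z - f w‖ ≤ D := by
        rw [← dist_eq_norm]
        exact hD (hmaps hz) (hmaps hw)
      have hD0 : 0 ≤ D := (norm_nonneg _).trans hfD
      have hzw : r / 2 ≤ ‖z - w‖ := by
        rw [← dist_eq_norm]
        linarith [dist_triangle_left w x z]
      have h3 := ncomp_nonneg Ω₁ π₁ z (z - w)
      have h4 := mul_nonneg (bdist_nonneg Ω₁ z) (norm_nonneg (z - w))
      calc _ ≤ ‖f z - f w‖ := hπ₂.ncomp_le_norm (hmaps hz) _
        _ ≤ D := hfD
        _ = D / (r / 2) ^ 2 * (r / 2) ^ 2 := by field_simp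
        _ ≤ D / (r / 2) ^ 2 * ‖z - w‖ ^ 2 := by gcongr
        _ ≤ _ := by gcongr; linarith

end InvDist
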